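/- Every vertex of a finite simple graph is contained in at least one minimal local set; hence every finite simple graph admits an MLS cover, a family of minimal local sets whose union is the whole vertex set. -/

import Mathlib

open Finset
open scoped Classical symmDiff

variable {V : Type*} [Fintype V] [DecidableEq V]

/-- The odd neighborhood of a set of vertices `D`: vertices having an odd
number of neighbors in `D`. -/
noncomputable def oddNbhd (G : SimpleGraph V) (D : Finset V) : Finset V :=
  Finset.univ.filter fun v => Odd (D.filter (G.Adj v)).card

/-- The cut-rank of `A`: the rank over `F₂` of the cut matrix between `A` and its complement. -/
noncomputable def cutrk (G : SimpleGraph V) (A : Finset V) : ℕ :=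
  (Matrix.of fun (a : {x // x ∈ A}) (b : {x // x ∈ Aᶜ}) =>
    if G.Adj a.1 b.1 then (1 : ZMod 2) else 0).rank

/-- A local set: a nonempty set of the form `D ∪ Odd(D)`. -/
noncomputable def IsLocalSet (G : SimpleGraph V) (A : Finset V) : Prop :=
  A.Nonempty ∧ ∃ D : Finset V, A = D ∪ oddNbhd G D

/-- A minimal local set: a local set minimal by inclusion. -/
noncomputable def IsMLS (G : SimpleGraph V) (A : Finset V) : Prop :=
  IsLocalSet G A ∧ ∀ B ⊂ A, ¬ IsLocalSet G B

/-- The adjacency operator over `F₂`. -/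
noncomputable def nbF (G : SimpleGraph V) (d : V → ZMod 2) (v : V) : ZMod 2 :=
  ∑ u, if G.Adj v u then d u else 0

lemma nbF_symm (G : SimpleGraph V) (c d : V → ZMod 2) :
    ∑ v, c v * nbF G d v = ∑ v, d v * nbF G c v := by
  unfold nbF
  simp only [Finset.mul_sum]
  rw [Finset.sum_comm]
  refine Finset.sum_congr rfl fun u _ => Finset.sum_congr rfl fun v _ => ?_
  by_cases h : G.Adj u v
  · simp [h, h.symm, mul_comm]
  · have h' : ¬ G.Adj v u := fun k => h k.symm
    simp [h, h']

lemma nbF_add (G : SimpleGraph V) (c d : V → ZMod 2) (v : V) :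
    nbF G (c + d) v = nbF G c v + nbF G d v := by
  unfold nbF
  rw [← Finset.sum_add_distrib]
  refine Finset.sum_congr rfl fun u _ => ?_
  split_ifs <;> simp

lemma nbF_smul (G : SimpleGraph V) (r : ZMod 2) (d : V → ZMod 2) (v : V) :
    nbF G (r • d) v = r * nbF G d v := by
  unfold nbF
  rw [Finset.mul_sum]
  refine Finset.sum_congr rfl fun u _ => ?_
  split_ifs <;> simp

lemma zmod2_cases (x : ZMod 2) : x = 0 ∨ x = 1 := by
  revert x; decide

/-- No nonempty local set inside `A`. -/
def FreeSet (G : SimpleGraph V) (A : Finset V) : Prop :=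
  ∀ d : V → ZMod 2, (∀ v, v ∉ A → d v = 0 ∧ nbF G d v = 0) → d = 0

lemma nbF_indicator (G : SimpleGraph V) (D : Finset V) (v : V) :
    nbF G (fun u => if u ∈ D then 1 else 0) v = 0 ↔ v ∉ oddNbhd G D := by
  have : nbF G (fun u => if u ∈ D then 1 else 0) v = ((D.filter (G.Adj v)).card : ZMod 2) := by
    unfold nbF
    rw [Finset.card_filter]
    push_cast
    rw [← Finset.sum_filter_add_sum_filter_not Finset.univ (fun u => u ∈ D)]
    rw [Finset.sum_eq_zero (s := Finset.univ.filter (fun u => ¬ u ∈ D))]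
    · rw [add_zero]
      refine Finset.sum_congr (by ext; simp) fun u hu => ?_
      simp [hu]
    · intro u hu
      simp at hu
      simp [hu]
  rw [this, ZMod.natCast_eq_zero_iff_even]
  simp [oddNbhd]

lemma exists_local_of_not_free (G : SimpleGraph V) (A : Finset V) (h : ¬ FreeSet G A) :
    ∃ L, IsLocalSet G L ∧ L ⊆ A := by
  unfold FreeSet at h
  push Not at h
  obtain ⟨d, hd, hne⟩ := h
  set D : Finset V := Finset.univ.filter (fun v => d v ≠ 0) with hD
  have hdD : d = fun u => if u ∈ D then 1 else 0 := by
    ext1 u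
    rcases zmod2_cases (d u) with h | h <;> simp [hD, h]
  refine ⟨D ∪ oddNbhd G D, ⟨?_, D, rfl⟩, ?_⟩
  · obtain ⟨v, hv⟩ := Function.ne_iff.mp hne
    exact ⟨v, Finset.mem_union_left _ (by simpa [hD] using hv)⟩
  · intro v hv
    by_contra hA
    obtain ⟨h1, h2⟩ := hd v hA
    rw [hdD, nbF_indicator] at h2
    rcases Finset.mem_union.mp hv with h | h
    · simp [hD] at h
      exact h h1
    · exact h2 h

lemma not_free_of_local (G : SimpleGraph V) (A L : Finset V) (hL : IsLocalSet G L) (hs : L ⊆ A) :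
    ¬ FreeSet G A := by
  intro hf
  obtain ⟨⟨x, hx⟩, D, rfl⟩ := hL
  have h := hf (fun u => if u ∈ D then 1 else 0) (by
    intro v hv
    have hv' : v ∉ D ∪ oddNbhd G D := fun k => hv (hs k)
    rw [Finset.mem_union, not_or] at hv'
    exact ⟨by simp [hv'.1], (nbF_indicator G D v).2 hv'.2⟩)
  have hD : ∀ u, u ∉ D := by
    intro u hu
    have := congrFun h u
    simp [hu] at this
  have : D = ∅ := Finset.eq_empty_of_forall_notMem hD
  subst this
  simp [oddNbhd] at hx

/-- If `A` is free, every vector agrees on `A` with the neighbourhood of a vector outside `A`. -/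
lemma free_surj (G : SimpleGraph V) (A : Finset V) (hf : FreeSet G A) (w : V → ZMod 2) :
    ∃ d : V → ZMod 2, (∀ v ∈ A, d v = 0) ∧ ∀ v ∈ A, nbF G d v = w v := by
  let R : Submodule (ZMod 2) (V → ZMod 2) :=
    { carrier := {w | ∃ d : V → ZMod 2, (∀ v ∈ A, d v = 0) ∧ ∀ v ∈ A, nbF G d v = w v}
      zero_mem' := ⟨0, by simp, by simp [nbF]⟩
      add_mem' := by
        rintro a b ⟨c, hc, hc'⟩ ⟨d, hd, hd'⟩
        exact ⟨c + d, fun v hv => by simp [hc v hv, hd v hv],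
          fun v hv => by simp [nbF_add, hc' v hv, hd' v hv]⟩
      smul_mem' := by
        rintro r b ⟨d, hd, hd'⟩
        exact ⟨r • d, fun v hv => by simp [hd v hv],
          fun v hv => by simp [nbF_smul, hd' v hv]⟩ }
  by_contra hw
  have hw' : w ∉ R := hw
  obtain ⟨f, hfw, hfR⟩ := Submodule.exists_le_ker_of_notMem hw'
  have hfe : ∀ x, f x = ∑ v, x v * f (Pi.single v 1) := by
    intro x
    conv_lhs => rw [pi_eq_sum_univ' x]
    rw [map_sum]
    refine Finset.sum_congr rfl fun v _ => ?_
    rw [map_smul, smul_eq_mul]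
  set g : V → ZMod 2 := fun v => f (Pi.single v 1) with hg
  have hzero : g = 0 := by
    apply hf
    intro v hv
    have hne : ∀ u ∈ A, (Pi.single v 1 : V → ZMod 2) u = 0 := by
      intro u hu
      have : u ≠ v := fun k => hv (k ▸ hu)
      simp [this]
    constructor
    · exact hfR (show _ ∈ R from ⟨0, by simp, fun u hu => by simp [nbF, hne u hu]⟩)
    · have h1 : f (nbF G (Pi.single v 1)) = 0 :=
        hfR (show _ ∈ R from ⟨Pi.single v 1, hne, fun _ _ => rfl⟩)
      rw [hfe] at h1
      have h2 := nbF_symm G g (Pi.single v 1)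
      simp only [mul_comm (g _)] at h2
      rw [h1] at h2
      simpa [Pi.single_apply] using h2.symm
  apply hfw
  rw [hfe]
  refine Finset.sum_eq_zero fun v _ => ?_
  have : f (Pi.single v 1) = 0 := congrFun hzero v
  rw [this, mul_zero]

lemma not_free_insert (G : SimpleGraph V) (a : V) (A : Finset V) (ha : a ∉ A)
    (hf : FreeSet G A) (hmax : ∀ b, b ≠ a → b ∉ A → ¬ FreeSet G (insert b A)) :
    ¬ FreeSet G (insert a A) := by
  intro hfa
  obtain ⟨d1, hd1, he1⟩ := free_surj G _ hfa (Pi.single a 1)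
  obtain ⟨z, hz, hz'⟩ := free_surj G _ hfa (nbF G (Pi.single a 1))
  set d2 : V → ZMod 2 := Pi.single a 1 + z with hd2def
  have hd2 : ∀ v ∈ A, d2 v = 0 := by
    intro v hv
    have : v ≠ a := fun k => ha (k ▸ hv)
    simp [hd2def, this, hz v (Finset.mem_insert_of_mem hv)]
  have hd2a : d2 a = 1 := by simp [hd2def, hz a (Finset.mem_insert_self _ _)]
  have he2 : ∀ v ∈ insert a A, nbF G d2 v = 0 := by
    intro v hv
    rw [hd2def, nbF_add, hz' v hv]
    exact CharTwo.add_self_eq_zero _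
  have he1' : ∀ v ∈ A, nbF G d1 v = 0 := by
    intro v hv
    have : v ≠ a := fun k => ha (k ▸ hv)
    rw [he1 v (Finset.mem_insert_of_mem hv)]
    simp [this]
  have hd1' : ∀ v ∈ A, d1 v = 0 := fun v hv => hd1 v (Finset.mem_insert_of_mem hv)
  have key : ∀ b, b ≠ a → b ∉ A → d1 b * nbF G d2 b = d2 b * nbF G d1 b := by
    intro b hb hbA
    have h := hmax b hb hbA
    unfold FreeSet at h
    push Not at h
    obtain ⟨c, hc, hc0⟩ := h
    have comm : ∀ d : V → ZMod 2, (∀ v ∈ A, d v = 0) → (∀ v ∈ A, nbF G d v = 0) →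
        c b * nbF G d b = d b * nbF G c b := by
      intro d h1 h2
      have h3 := nbF_symm G c d
      rw [Finset.sum_eq_single b, Finset.sum_eq_single b] at h3
      · exact h3
      · intro v _ hvb
        by_cases hv : v ∈ A
        · simp [h1 v hv]
        · simp [(hc v (by simp [hv, hvb])).2]
      · simp
      · intro v _ hvb
        by_cases hv : v ∈ A
        · simp [h2 v hv]
        · simp [(hc v (by simp [hv, hvb])).1]
      · simp
    have k1 := comm d1 hd1' he1'
    have k2 := comm d2 hd2 (fun v hv => he2 v (Finset.mem_insert_of_mem hv))
    have hpq : ¬ (c b = 0 ∧ nbF G c b = 0) := by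
      intro hh
      apply hc0
      apply hf
      intro v hv
      by_cases hvb : v = b
      · subst hvb; exact hh
      · exact hc v (by simp [hv, hvb])
    generalize c b = p at *
    generalize nbF G c b = q at *
    generalize nbF G d1 b = x at *
    generalize nbF G d2 b = y at *
    generalize d1 b = s at *
    generalize d2 b = t at *
    clear * - k1 k2 hpq
    revert p q x y s t
    decide
  have hs := nbF_symm G d1 d2
  rw [← Finset.sum_erase_add _ _ (Finset.mem_univ a),
    ← Finset.sum_erase_add (f := fun v => d2 v * nbF G d1 v) _ (h := Finset.mem_univ a)] at hs
  rw [Finset.sum_congr (g := fun v => d2 v * nbF G d1 v) rfl] at hs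
  · have := add_left_cancel hs
    rw [hd1 a (Finset.mem_insert_self _ _), hd2a, he1 a (Finset.mem_insert_self _ _)] at this
    simp at this
  · intro v hv
    have hva : v ≠ a := Finset.ne_of_mem_erase hv
    by_cases hvA : v ∈ A
    · simp [hd1' v hvA, hd2 v hvA]
    · exact key v hva hvA

lemma exists_MLS_mem (G : SimpleGraph V) (a : V) : ∃ L : Finset V, IsMLS G L ∧ a ∈ L := by
  have hne : (Finset.univ.filter (fun A : Finset V => a ∉ A ∧ FreeSet G A)).Nonempty := by
    refine ⟨∅, ?_⟩
    simp only [Finset.mem_filter, Finset.mem_univ, true_and]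
    exact ⟨by simp, fun d hd => funext fun v => (hd v (by simp)).1⟩
  obtain ⟨A, hA, hAmax⟩ := Finset.exists_max_image _ Finset.card hne
  simp only [Finset.mem_filter, Finset.mem_univ, true_and] at hA hAmax
  have hnf := not_free_insert G a A hA.1 hA.2 (by
    intro b hb hbA hfr
    have := hAmax (insert b A) ⟨by simp [hA.1, hb.symm], hfr⟩
    rw [Finset.card_insert_of_notMem hbA] at this
    omega)
  obtain ⟨L0, hL0, hL0s⟩ := exists_local_of_not_free G _ hnf
  have hne2 : (Finset.univ.filter
      (fun L : Finset V => IsLocalSet G L ∧ L ⊆ insert a A)).Nonempty :=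
    ⟨L0, by simp only [Finset.mem_filter, Finset.mem_univ, true_and]; exact ⟨hL0, hL0s⟩⟩
  obtain ⟨L, hL, hLmin⟩ := Finset.exists_min_image _ Finset.card hne2
  simp only [Finset.mem_filter, Finset.mem_univ, true_and] at hL hLmin
  refine ⟨L, ⟨hL.1, fun B hB hBl => ?_⟩, ?_⟩
  · have := hLmin B ⟨hBl, hB.subset.trans hL.2⟩
    have := Finset.card_lt_card hB
    omega
  · by_contra haL
    exact not_free_of_local G A L hL.1 ((Finset.subset_insert_iff_of_notMem haL).1 hL.2) hA.2

theorem MLS_cover_exists (G : SimpleGraph V) :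
    (∀ a : V, ∃ L : Finset V, IsMLS G L ∧ a ∈ L) ∧
      ∃ 𝓛 : Finset (Finset V), (∀ L ∈ 𝓛, IsMLS G L) ∧ ∀ a : V, ∃ L ∈ 𝓛, a ∈ L := by
  refine ⟨exists_MLS_mem G, Finset.univ.filter (IsMLS G), ?_, ?_⟩
  · intro L hL
    exact (Finset.mem_filter.1 hL).2
  · intro a
    obtain ⟨L, hL, ha⟩ := exists_MLS_mem G a
    exact ⟨L, Finset.mem_filter.2 ⟨Finset.mem_univ _, hL⟩, ha⟩
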